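/- arXiv:2506.23198 — 2 statements merged into one kernel-verified Lean document; each statement's English description precedes it below -/
import Mathlib

section
/- Let p be an odd prime, n even, m | n with m ≤ n/2. Let F: F_{p^n} → F_{p^m} be defined by F(x) = Tr_{p^n/p^m}(e x²) for a fixed e ∈ F_{p^n}^*, and suppose n/m is even. Then the number of x ∈ F_{p^n} with F(x) = 0 equals p^{n−m} + ε p^{n/2 − m}(p^m − 1), where ε = −ϵ^n η_n(e), ϵ = sqrt((−1)^{(p−1)/2}), and η_n is the quadratic character of F_{p^n}. -/
open Finset

section TraceZeros

variable {K M L : Type*} [Field K] [Field M] [Field L] [Algebra K L] [Algebra M L]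

theorem card_trace_eq_zero_mul_card [Fintype K] [DecidableEq K] [Fintype L] :
    #{x : L | Algebra.trace K L x = 0} * Fintype.card K = Fintype.card L := by
  have h := (Algebra.trace K L).toAddMonoidHom.ker.card_eq_card_quotient_mul_card_addSubgroup
  rw [Nat.card_congr (QuotientAddGroup.quotientKerEquivOfSurjective _
    (Algebra.trace_surjective K L)).toEquiv] at h
  rw [← Nat.card_eq_fintype_card, ← Nat.card_eq_fintype_card, h, mul_comm]
  congr 1
  rw [← Fintype.card_subtype, ← Nat.card_eq_fintype_card]
  rfl

theorem card_eq_sq_of_finrank_eq_two [Fintype M] [Fintype L]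
    (h2 : Module.finrank M L = 2) :
    Fintype.card L = Fintype.card M ^ 2 := by
  rw [Module.card_eq_pow_finrank (K := M) (V := L), h2]

theorem odd_card_of_ringChar_ne_two [Fintype M]
    (hL : ringChar L ≠ 2) : Odd (Fintype.card M) := by
  rw [← Algebra.ringChar_eq M L] at hL
  exact Nat.odd_iff.mpr (FiniteField.odd_card_of_char_ne_two hL)

theorem card_div_two_of_finrank_eq_two [Fintype M] [Fintype L]
    (h2 : Module.finrank M L = 2) (hL : ringChar L ≠ 2) :
    Fintype.card L / 2 = (Fintype.card M - 1) * ((Fintype.card M + 1) / 2) := by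
  obtain ⟨k, hk⟩ := odd_card_of_ringChar_ne_two (M := M) hL
  rw [card_eq_sq_of_finrank_eq_two h2, hk]
  have h1 : (2 * k + 1) ^ 2 = 2 * (2 * k * (k + 1)) + 1 := by ring
  have h3 : (2 * k + 1 + 1) / 2 = k + 1 := by omega
  rw [h1, h3, Nat.add_sub_cancel]
  omega

theorem quadraticChar_algebraMap_of_finrank_eq_two [Fintype M] [Fintype L] [DecidableEq L]
    (h2 : Module.finrank M L = 2)
    (hL : ringChar L ≠ 2) {y : M} (hy : y ≠ 0) : quadraticChar L (algebraMap M L y) = 1 := by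
  have hy' : algebraMap M L y ≠ 0 := by simpa using hy
  rw [quadraticChar_one_iff_isSquare hy', FiniteField.isSquare_iff hL hy',
    card_div_two_of_finrank_eq_two h2 hL, pow_mul, ← map_pow,
    FiniteField.pow_card_sub_one_eq_one y hy]
  simp

theorem quadraticChar_of_trace_eq_zero [Fintype M] [Fintype L] [DecidableEq L]
    (h2 : Module.finrank M L = 2) (hL : ringChar L ≠ 2)
    {u : L} (hu : u ≠ 0) (htr : Algebra.trace M L u = 0) :
    quadraticChar L u = (-1) ^ ((Fintype.card M + 1) / 2) := by
  have h := FiniteField.algebraMap_trace_eq_sum_pow M L u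
  rw [htr, h2, sum_range_succ, sum_range_one, map_zero, pow_zero, pow_one, pow_one,
    Nat.card_eq_fintype_card] at h
  have h1 : u ^ (Fintype.card M - 1) = -1 := by
    apply mul_right_cancel₀ hu
    rw [← pow_succ, Nat.sub_add_cancel Fintype.card_pos]
    linear_combination -h
  have h3 := quadraticChar_eq_pow_of_char_ne_two hL hu
  rw [card_div_two_of_finrank_eq_two h2 hL, pow_mul, h1] at h3
  rw [h3]
  rcases Nat.even_or_odd ((Fintype.card M + 1) / 2) with h | h
  · simp [h.neg_one_pow]
  · simp [h.neg_one_pow, Ring.neg_one_ne_one_of_char_ne_two hL]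

theorem sum_quadraticChar_trace_eq_zero_of_finrank_eq_two [Fintype M] [DecidableEq M]
    [Fintype L] [DecidableEq L]
    (h2 : Module.finrank M L = 2)
    (hL : ringChar L ≠ 2) :
    ∑ u : L with Algebra.trace M L u = 0, quadraticChar L u
      = ((Fintype.card M : ℤ) - 1) * (-1) ^ ((Fintype.card M + 1) / 2) := by
  have h0 : (0 : L) ∈ ({u : L | Algebra.trace M L u = 0} : Finset L) := by simp
  have hc : #{u : L | Algebra.trace M L u = 0} = Fintype.card M := by
    have := card_trace_eq_zero_mul_card (K := M) (L := L)
    rw [card_eq_sq_of_finrank_eq_two h2, sq] at this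
    exact Nat.eq_of_mul_eq_mul_right Fintype.card_pos this
  rw [← add_sum_erase _ _ h0, sum_congr rfl
    (g := fun _ => (-1 : ℤ) ^ ((Fintype.card M + 1) / 2)), sum_const, card_erase_of_mem h0, hc]
  · simp [Nat.cast_sub (Fintype.card_pos (α := M))]
  · intro u hu
    rw [mem_erase, mem_filter] at hu
    exact quadraticChar_of_trace_eq_zero h2 hL hu.1 hu.2.2

theorem card_trace_smul_eq_zero [DecidableEq K] [Fintype M] [DecidableEq M] [Fintype L]
    [Algebra K M] [IsScalarTower K M L]
    (u : L) :
    #{y : M | Algebra.trace K L (y • u) = 0} =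
      if Algebra.trace M L u = 0 then Fintype.card M
      else #{y : M | Algebra.trace K M y = 0} := by
  have h : ∀ y : M, Algebra.trace K L (y • u) = Algebra.trace K M (y * Algebra.trace M L u) := by
    intro y
    rw [← Algebra.trace_trace (S := M), map_smul, smul_eq_mul]
  simp_rw [h]
  split_ifs with hu
  · simp [hu]
  · refine card_equiv (Equiv.mulRight₀ _ hu) ?_
    simp

theorem sum_quadraticChar_trace_smul [DecidableEq K] [Fintype M] [Fintype L] [DecidableEq L]
    (h2 : Module.finrank M L = 2) (hL : ringChar L ≠ 2)
    {y : M} (hy : y ≠ 0) :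
    ∑ u : L with Algebra.trace K L (y • u) = 0, quadraticChar L u
      = ∑ u : L with Algebra.trace K L u = 0, quadraticChar L u := by
  have hy' : algebraMap M L y ≠ 0 := by simpa using hy
  refine sum_equiv (Equiv.mulLeft₀ _ hy') ?_ ?_
  · simp [Algebra.smul_def]
  · intro u _
    rw [Equiv.mulLeft₀_apply, map_mul, quadraticChar_algebraMap_of_finrank_eq_two h2 hL hy,
      one_mul]

theorem sum_quadraticChar_trace_eq_zero [DecidableEq K] [Fintype M] [DecidableEq M]
    [Fintype L] [DecidableEq L] [Algebra K M] [IsScalarTower K M L]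
    (h2 : Module.finrank M L = 2) (hL : ringChar L ≠ 2) :
    ∑ u : L with Algebra.trace K L u = 0, quadraticChar L u
      = ((Fintype.card M : ℤ) - #{y : M | Algebra.trace K M y = 0})
        * (-1) ^ ((Fintype.card M + 1) / 2) := by
  set S := ∑ u : L with Algebra.trace K L u = 0, quadraticChar L u
  set k := #{y : M | Algebra.trace K M y = 0} with hk
  have hswap : ∑ y : M, ∑ u : L with Algebra.trace K L (y • u) = 0, quadraticChar L u
      = ∑ u : L, quadraticChar L u * #{y : M | Algebra.trace K L (y • u) = 0} := by
    simp_rw [sum_filter]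
    rw [sum_comm]
    refine sum_congr rfl fun u _ => ?_
    rw [← sum_filter, sum_const, nsmul_eq_mul, mul_comm]
  have hleft : ∑ y : M, ∑ u : L with Algebra.trace K L (y • u) = 0, quadraticChar L u
      = ((Fintype.card M : ℤ) - 1) * S := by
    have hzero : ∑ u : L with Algebra.trace K L ((0 : M) • u) = 0, quadraticChar L u = 0 := by
      simp_rw [zero_smul, map_zero, filter_true]
      exact quadraticChar_sum_zero hL
    have hne : ∀ y ∈ univ.erase (0 : M),
        ∑ u : L with Algebra.trace K L (y • u) = 0, quadraticChar L u = S := fun y hy =>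
      sum_quadraticChar_trace_smul h2 hL (ne_of_mem_erase hy)
    rw [← add_sum_erase _ _ (mem_univ (0 : M)), hzero, sum_congr rfl hne, sum_const,
      card_erase_of_mem (mem_univ _), zero_add, nsmul_eq_mul, card_univ,
      Nat.cast_sub Fintype.card_pos, Nat.cast_one]
  have hright : ∑ u : L, quadraticChar L u * #{y : M | Algebra.trace K L (y • u) = 0}
      = ((Fintype.card M : ℤ) - k) * (((Fintype.card M : ℤ) - 1)
        * (-1) ^ ((Fintype.card M + 1) / 2)) := by
    have hterm : ∀ u : L, quadraticChar L u * #{y : M | Algebra.trace K L (y • u) = 0}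
        = quadraticChar L u * (k : ℤ) + ((Fintype.card M : ℤ) - k)
          * (if Algebra.trace M L u = 0 then quadraticChar L u else 0) := by
      intro u
      rw [card_trace_smul_eq_zero, ← hk]
      split_ifs <;> ring
    rw [sum_congr rfl fun u _ => hterm u, sum_add_distrib, ← sum_mul, ← mul_sum, ← sum_filter,
      quadraticChar_sum_zero hL, sum_quadraticChar_trace_eq_zero_of_finrank_eq_two h2 hL,
      zero_mul, zero_add]
  have hM : (Fintype.card M : ℤ) - 1 ≠ 0 := by
    have := Fintype.one_lt_card (α := M)
    omega
  apply mul_left_cancel₀ hM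
  rw [← hleft, hswap, hright]
  ring

theorem card_trace_mul_sq_eq_zero [DecidableEq K] [Fintype L] [DecidableEq L]
    (hL : ringChar L ≠ 2) {e : L} (he : e ≠ 0) :
    (#{x : L | Algebra.trace K L (e * x ^ 2) = 0} : ℤ)
      = #{u : L | Algebra.trace K L u = 0}
        + quadraticChar L e * ∑ u : L with Algebra.trace K L u = 0, quadraticChar L u := by
  have h1 : #{x : L | Algebra.trace K L (e * x ^ 2) = 0}
      = ∑ u : L with Algebra.trace K L (e * u) = 0, #{x : L | x ^ 2 = u} := by
    rw [card_eq_sum_card_fiberwise (f := fun x : L => x ^ 2)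
      (t := ({u : L | Algebra.trace K L (e * u) = 0} : Finset L))]
    · refine sum_congr rfl fun u hu => ?_
      congr 1
      ext x
      simp only [mem_filter, mem_univ, true_and] at hu ⊢
      exact ⟨fun h => h.2, fun h => ⟨by rwa [h], h⟩⟩
    · intro x hx
      simpa using hx
  have h2 : ∀ u : L, (#{x : L | x ^ 2 = u} : ℤ) = quadraticChar L u + 1 := by
    intro u
    rw [← quadraticChar_card_sqrts hL u]
    congr 2
    ext x
    simp
  rw [h1, Nat.cast_sum, card_eq_sum_ones, Nat.cast_sum, mul_sum, ← sum_add_distrib]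
  refine sum_equiv (Equiv.mulLeft₀ _ he) (by simp) fun u _ => ?_
  have h3 := quadraticChar_sq_one he
  rw [h2]
  simp only [Equiv.mulLeft₀_apply, map_mul, Nat.cast_one]
  linear_combination (-quadraticChar L u) * h3

end TraceZeros

theorem exists_intermediateField_finrank_eq_two {K L : Type*} [Field K] [Field L] [Finite L]
    [Algebra K L] (h : Even (Module.finrank K L)) :
    ∃ M : IntermediateField K L, Module.finrank M L = 2 := by
  have : Finite K := Finite.of_injective _ (algebraMap K L).injective
  have hd : 2 ∣ Nat.card (L ≃ₐ[K] L) := by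
    rw [IsGalois.card_aut_eq_finrank]
    exact h.two_dvd
  obtain ⟨σ, hσ⟩ := exists_prime_orderOf_dvd_card' 2 hd
  refine ⟨IntermediateField.fixedField (Subgroup.zpowers σ), ?_⟩
  rw [IntermediateField.finrank_fixedField_eq_card, Nat.card_zpowers, hσ]

theorem neg_one_pow_pow_add_one_div_two {p : ℕ} (hp : Odd p) (k : ℕ) :
    (-1 : ℤ) ^ ((p ^ k + 1) / 2) = -(((-1 : ℤ) ^ ((p - 1) / 2)) ^ k) := by
  have h1 : (p ^ k + 1) / 2 = p ^ k / 2 + 1 := by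
    have := Nat.odd_iff.mp (hp.pow (n := k))
    omega
  have h2 : (p - 1) / 2 = p / 2 := by
    have := Nat.odd_iff.mp hp
    omega
  rw [h1, h2, pow_succ, ← ZMod.χ₄_eq_neg_one_pow (Nat.odd_iff.mp hp),
    ← ZMod.χ₄_eq_neg_one_pow (Nat.odd_iff.mp hp.pow), Nat.cast_pow, map_pow, mul_neg_one]



/-- Let `p` be an odd prime, `m ∣ n` with `n/m` even (so `n` is even and
`m ≤ n/2`), and `F(x) = Tr_{p^n/p^m}(e x²)` for a fixed `e ∈ F_{p^n}^*`.
Then `#{x ∈ F_{p^n} : F(x) = 0} = p^{n-m} + ε p^{n/2-m}(p^m - 1)`, where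
`ε = -ϵ^n η_n(e)` with `ϵ² = (-1)^{(p-1)/2}` (so `ϵ^n = ((-1)^{(p-1)/2})^{n/2}`)
and `η_n` the quadratic character of `F_{p^n}`. -/
theorem count_zeros_trace_quadratic_form (p m n : ℕ) [Fact p.Prime] (hp : p ≠ 2)
    (hm : 1 ≤ m) (hmn : m ∣ n) (heven : Even (n / m)) (hn : Even n)
    (hm2 : m ≤ n / 2)
    (K L : Type*) [Field K] [Fintype K] [DecidableEq K]
    [Field L] [Fintype L] [DecidableEq L] [Algebra K L]
    (hK : Fintype.card K = p ^ m) (hL : Fintype.card L = p ^ n)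
    (e : L) (he : e ≠ 0) :
    ((Finset.univ.filter
        (fun x : L => Algebra.trace K L (e * x ^ 2) = 0)).card : ℤ)
      = (p : ℤ) ^ (n - m)
        + (-(((-1 : ℤ) ^ ((p - 1) / 2)) ^ (n / 2)) * quadraticChar L e)
          * (p : ℤ) ^ (n / 2 - m) * ((p : ℤ) ^ m - 1) := by
  classical
  have hp1 : 1 < p := (Fact.out : p.Prime).one_lt
  have hpodd : Odd p := (Fact.out : p.Prime).odd_of_ne_two hp
  have hchar : ringChar L ≠ 2 := by
    intro h
    have h1 := FiniteField.even_card_of_char_two h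
    rw [hL] at h1
    have h2 := Nat.odd_iff.mp (hpodd.pow (n := n))
    omega
  have hrank : Module.finrank K L = n / m := by
    have h := Module.card_eq_pow_finrank (K := K) (V := L)
    rw [hK, hL, ← pow_mul] at h
    rw [Nat.pow_right_injective hp1 h, Nat.mul_div_cancel_left _ hm]
  obtain ⟨M, hM⟩ := exists_intermediateField_finrank_eq_two (hrank ▸ heven)
  have hMcard : Fintype.card M = p ^ (n / 2) := by
    have h := card_eq_sq_of_finrank_eq_two hM
    rw [hL, ← Nat.div_mul_cancel hn.two_dvd, pow_mul] at h
    exact (Nat.pow_left_injective two_ne_zero h).symm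
  have hkerL : #{u : L | Algebra.trace K L u = 0} = p ^ (n - m) := by
    have h := card_trace_eq_zero_mul_card (K := K) (L := L)
    rw [hK, hL, ← Nat.sub_add_cancel (hm2.trans (Nat.div_le_self n 2)), pow_add] at h
    exact Nat.eq_of_mul_eq_mul_right (by positivity) h
  have hkerM : #{y : M | Algebra.trace K M y = 0} = p ^ (n / 2 - m) := by
    have h := card_trace_eq_zero_mul_card (K := K) (L := M)
    rw [hK, hMcard, ← Nat.sub_add_cancel hm2, pow_add] at h
    exact Nat.eq_of_mul_eq_mul_right (by positivity) h
  have hpow : (p : ℤ) ^ (n / 2) = (p : ℤ) ^ (n / 2 - m) * (p : ℤ) ^ m := by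
    rw [← pow_add, Nat.sub_add_cancel hm2]
  rw [card_trace_mul_sq_eq_zero hchar he, sum_quadraticChar_trace_eq_zero hM hchar, hkerL, hkerM,
    hMcard, neg_one_pow_pow_add_one_div_two hpodd]
  push_cast
  rw [hpow]
  ring
end

section
/- Let p be an odd prime and F: V → F_{p^m} a vectorial dual-bent function satisfying Condition II with constant υ ∈ {±ϵ^m}. Let η_m be the quadratic character of F_{p^m}, χ_1 the canonical additive character of V, and a ∈ V \ {0}. Then S_2 := Σ_{x ∈ V} η_m(F(x)) χ_1(ax) equals ((p^m−1)/p^m) υ p^{n/2} (−1)^{m−1} ϵ^m √(p^m) η_m(−1) if F^*(a) = 0, and equals −(1/p^m) υ p^{n/2} (−1)^{m−1} ϵ^m √(p^m) η_m(−1) if F^*(a) ≠ 0. -/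
open Complex Finset

/-- `ζ_p^k` for `k ∈ Z/p`. -/
noncomputable def zetaP (p : ℕ) (k : ZMod p) : ℂ :=
  Complex.exp (2 * Real.pi * Complex.I * (k.val : ℂ) / p)

/-- `ϵ = sqrt((-1)^{(p-1)/2})`: equal to `1` if `p ≡ 1 (mod 4)` and `i`
otherwise. -/
noncomputable def epsC (p : ℕ) : ℂ := if p % 4 = 1 then 1 else Complex.I

section EulerOperator

open Polynomial

variable {R : Type*} [CommRing R]

/-- The Euler operator `f ↦ X * derivative f` on polynomials. -/
noncomputable def eulerOp (R : Type*) [CommRing R] : Module.End R R[X] :=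
  LinearMap.mulLeft R X ∘ₗ derivative

lemma eulerOp_apply (f : R[X]) : eulerOp R f = X * derivative f := rfl

lemma eulerOp_pow_C_mul_X_pow (k : ℕ) (a : R) (j : ℕ) :
    (eulerOp R ^ k) (C a * X ^ j) = C (a * (j : R) ^ k) * X ^ j := by
  induction k with
  | zero => simp
  | succ k ih =>
    rw [pow_succ', Module.End.mul_apply, ih, eulerOp_apply, derivative_C_mul_X_pow]
    rcases j with _ | j
    · simp
    · simp only [Nat.add_sub_cancel, C_mul, C_pow, pow_succ]
      ring

lemma eval_one_eulerOp_pow_X_sub_one_pow_mul (k : ℕ) (g : R[X]) :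
    eval 1 ((eulerOp R ^ k) ((X - 1) ^ k * g)) = (k.factorial : R) * eval 1 g := by
  induction k generalizing g with
  | zero => simp
  | succ k ih =>
    have h : eulerOp R ((X - 1) ^ (k + 1) * g)
        = (X - 1) ^ k * (((k + 1 : ℕ) : R[X]) * X * g + (X - 1) * X * derivative g) := by
      rw [eulerOp_apply, derivative_mul, derivative_pow]
      simp
      ring
    rw [pow_succ, Module.End.mul_apply, h, ih]
    simp [Nat.factorial_succ]
    ring

/-- If the `p`-th cyclotomic polynomial divides `∑ (j/p) X^j - s ∏_{k ≤ h} (X^k - X^(p-k))`,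
where `p = 2 * h + 1`, then the sign `s` is `(-1)^h (2/p)`. -/
lemma sign_eq_of_cyclotomic_dvd {p h : ℕ} [Fact p.Prime] (hph : p = 2 * h + 1)
    {s : ℤ} (hs : s = 1 ∨ s = -1)
    (hdvd : cyclotomic p ℤ ∣ ∑ j ∈ range p, C (quadraticChar (ZMod p) (j : ZMod p)) * X ^ j
      - C s * ∏ k ∈ range h, (X ^ (k + 1) - X ^ (p - (k + 1)))) :
    s = (-1) ^ h * quadraticChar (ZMod p) 2 := by
  have hp2 : p ≠ 2 := by omega
  have hh : 0 < h := by
    have := (Fact.out : p.Prime).two_le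
    omega
  have hchar : ringChar (ZMod p) ≠ 2 := by rwa [ZMod.ringChar_zmod_n]
  have hcard : Fintype.card (ZMod p) / 2 = h := by rw [ZMod.card]; omega
  have hχ (a : ZMod p) : (quadraticChar (ZMod p) a : ZMod p) = a ^ h := by
    rw [quadraticChar_eq_pow_of_char_ne_two' hchar, hcard]
  have h2 : (2 : ZMod p) ≠ 0 := by
    exact Ring.two_ne_zero hchar
  obtain ⟨q, hq⟩ := hdvd
  have hcyc : cyclotomic p (ZMod p) = (X - 1) ^ (p - 1) := by
    have := cyclotomic_mul_prime_eq_pow_of_not_dvd (ZMod p) (p := p) (n := 1)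
      (Fact.out : p.Prime).not_dvd_one
    rwa [one_mul, cyclotomic_one] at this
  have hq' := congrArg (Polynomial.map (Int.castRingHom (ZMod p))) hq
  simp only [Polynomial.map_sub, Polynomial.map_mul, map_cyclotomic, hcyc, Polynomial.map_sum,
    Polynomial.map_prod, Polynomial.map_pow, map_X, map_C,
    Int.coe_castRingHom, hχ] at hq'
  have hfac : ∏ k ∈ range h, ((X : (ZMod p)[X]) ^ (k + 1) - X ^ (p - (k + 1)))
      = (X - 1) ^ h * ∏ k ∈ range h,
        (∑ i ∈ range (k + 1), X ^ i - ∑ i ∈ range (p - (k + 1)), X ^ i) := by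
    rw [← card_range h, ← prod_const, card_range, ← prod_mul_distrib]
    refine prod_congr rfl fun k _ => ?_
    rw [mul_sub, mul_geom_sum, mul_geom_sum]
    ring
  have hsplit : ((X : (ZMod p)[X]) - 1) ^ (p - 1) * Polynomial.map (Int.castRingHom (ZMod p)) q
      = (X - 1) ^ h * ((X - 1) ^ h * Polynomial.map (Int.castRingHom (ZMod p)) q) := by
    rw [← mul_assoc, ← pow_add]
    congr 2
    omega
  rw [hfac, hsplit, mul_left_comm (C (s : ZMod p))] at hq'
  have hev := congrArg (fun f => eval 1 ((eulerOp (ZMod p) ^ h) f)) hq'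
  simp only [map_sub, map_sum, eulerOp_pow_C_mul_X_pow, eval_sub, eval_finsetSum,
    eval_one_eulerOp_pow_X_sub_one_pow_mul] at hev
  simp only [eval_finsetSum, eval_mul, eval_C, eval_pow, eval_X, one_pow, mul_one, eval_prod,
    eval_sub, eval_one, sub_self, zero_pow hh.ne', zero_mul, mul_zero, sum_const, card_range,
    nsmul_eq_mul] at hev
  have hsum : ∑ j ∈ range p, (j : ZMod p) ^ h * (j : ZMod p) ^ h = -1 := by
    have h1 (j : ℕ) (hj : j ∈ range (2 * h)) :
        ((j + 1 : ℕ) : ZMod p) ^ h * ((j + 1 : ℕ) : ZMod p) ^ h = 1 := by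
      rw [← pow_add, show h + h = p - 1 by omega]
      refine ZMod.pow_card_sub_one_eq_one fun h0 => ?_
      have := Nat.le_of_dvd j.succ_pos ((ZMod.natCast_eq_zero_iff _ _).mp h0)
      have := mem_range.mp hj
      omega
    rw [show range p = range (2 * h + 1) by rw [hph], sum_range_succ', sum_congr rfl h1]
    have h3 : ((2 * h + 1 : ℕ) : ZMod p) = 0 := by rw [← hph, CharP.cast_eq_zero]
    push_cast at h3
    simp [hh.ne']
    linear_combination h3
  have hprod : ∏ k ∈ range h, (((k + 1 : ℕ) : ZMod p) - ((p - (k + 1) : ℕ) : ZMod p))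
      = 2 ^ h * (h.factorial : ZMod p) := by
    rw [← prod_range_add_one_eq_factorial, Nat.cast_prod, ← card_range h, ← prod_const, card_range,
      ← prod_mul_distrib]
    refine prod_congr rfl fun k hk => ?_
    have := mem_range.mp hk
    rw [Nat.cast_sub (by omega), CharP.cast_eq_zero (ZMod p) p]
    push_cast
    ring
  have hwil : (h.factorial : ZMod p) * h.factorial * (-1) ^ h = -1 := by
    refine Eq.trans ?_ (ZMod.wilsons_lemma p)
    rw [← prod_range_add_one_eq_factorial,
      ← prod_range_add_one_eq_factorial, show p - 1 = h + h by omega, prod_range_add,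
      Nat.cast_mul, mul_assoc]
    congr 1
    have hc : (-1 : ZMod p) ^ h = ∏ k ∈ range h, (-1 : ZMod p) := by simp
    rw [← prod_range_reflect (fun x => h + x + 1), Nat.cast_prod, Nat.cast_prod, hc,
      ← prod_mul_distrib]
    refine prod_congr rfl fun k hk => ?_
    have := mem_range.mp hk
    have h3 : ((h + (h - 1 - k) + 1 : ℕ) : ZMod p) + ((k + 1 : ℕ) : ZMod p) = 0 := by
      rw [← Nat.cast_add, show h + (h - 1 - k) + 1 + (k + 1) = p by omega, CharP.cast_eq_zero]
    linear_combination -h3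
  rw [hsum, hprod] at hev
  have key : ((s * ((-1) ^ h * quadraticChar (ZMod p) 2) : ℤ) : ZMod p) = 1 := by
    push_cast
    rw [hχ]
    have h4 : ((-1 : ZMod p) ^ h) * (-1) ^ h = 1 := by
      rw [← mul_pow]; simp
    linear_combination (-1) ^ h * ((-1) ^ h * hev + s * 2 ^ h * hwil) + h4
  have h5 : s * ((-1) ^ h * quadraticChar (ZMod p) 2) = 1 := by
    refine Int.cast_injOn_of_ringChar_ne_two hchar ?_ (by simp) (by rwa [Int.cast_one])
    rcases hs with rfl | rfl <;> rcases neg_one_pow_eq_or ℤ h with h5 | h5 <;>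
      rcases quadraticChar_dichotomy h2 with h6 | h6 <;> rw [h5, h6] <;> simp
  have h6 : s * s = 1 := by rcases hs with rfl | rfl <;> rfl
  linear_combination ((-1) ^ h * quadraticChar (ZMod p) 2) * h6 - s * h5

end EulerOperator

section QuadraticGaussSum

/-- The quadratic character of a finite field with complex values. -/
noncomputable def complexQuadraticChar (K : Type*) [Field K] [Fintype K] [DecidableEq K] :
    MulChar K ℂ :=
  (quadraticChar K).ringHomComp (Int.castRingHom ℂ)

variable {K : Type*} [Field K] [Fintype K] [DecidableEq K]

lemma complexQuadraticChar_apply (x : K) :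
    complexQuadraticChar K x = (quadraticChar K x : ℂ) := rfl

lemma complexQuadraticChar_isQuadratic : (complexQuadraticChar K).IsQuadratic :=
  (quadraticChar_isQuadratic K).comp _

lemma complexQuadraticChar_ne_one (hK : ringChar K ≠ 2) : complexQuadraticChar K ≠ 1 :=
  (MulChar.ringHomComp_ne_one_iff (RingHom.injective_int _)).mpr (quadraticChar_ne_one hK)

lemma sum_addChar_mul_sq (hK : ringChar K ≠ 2) {ψ : AddChar K ℂ} (hψ : ψ.IsPrimitive)
    {a : K} (ha : a ≠ 0) :
    ∑ x, ψ (a * x ^ 2) = (quadraticChar K a : ℂ) * gaussSum (complexQuadraticChar K) ψ := by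
  have h1 : ∑ x, ψ (a * x ^ 2)
      = ∑ y, ((quadraticChar K y : ℂ) + 1) * ψ (a * y) := by
    rw [← sum_fiberwise univ (fun x : K => x ^ 2)]
    refine sum_congr rfl fun y _ => ?_
    rw [sum_congr rfl (g := fun _ => ψ (a * y)) fun x hx => by rw [(mem_filter.mp hx).2], sum_const,
      nsmul_eq_mul]
    congr 1
    have := quadraticChar_card_sqrts hK y
    rw [Set.toFinset_ofPred] at this
    exact_mod_cast this
  have h2 : ∑ y, ψ (a * y) = 0 := by
    have := AddChar.sum_eq_zero_of_ne_one (hψ ha)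
    simpa [AddChar.mulShift_apply] using this
  have h3 := gaussSum_mulShift_eq (complexQuadraticChar K) ψ (Units.mk0 a ha)
  rw [complexQuadraticChar_isQuadratic.inv] at h3
  rw [h1]
  simp only [add_mul, sum_add_distrib, one_mul, h2, add_zero]
  exact h3

omit [DecidableEq K] in
/-- Stickelberger's parity theorem for finite fields. -/
lemma quadraticChar_discr {p m : ℕ} [Fact p.Prime] (hp : p ≠ 2)
    [Algebra (ZMod p) K] (hm : Module.finrank (ZMod p) K = m)
    (v : Module.Basis (Fin m) (ZMod p) K) :
    quadraticChar (ZMod p) (Algebra.discr (ZMod p) v) = (-1) ^ (m - 1) := by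
  have hchar : ringChar (ZMod p) ≠ 2 := by rwa [ZMod.ringChar_zmod_n]
  have hmpos : 0 < m := hm ▸ Module.finrank_pos
  have : NeZero m := ⟨hmpos.ne'⟩
  have : CharP K p := charP_of_injective_algebraMap' (ZMod p) p
  have hcardK : Fintype.card K = p ^ m := by
    rw [Module.card_eq_pow_finrank (K := ZMod p), ZMod.card, hm]
  let M : Matrix (Fin m) (Fin m) K := Matrix.of fun i j => v j ^ p ^ (i : ℕ)
  have hsq : algebraMap (ZMod p) K (Algebra.discr (ZMod p) v) = M.det ^ 2 := by
    rw [Algebra.discr_def, RingHom.map_det, sq]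
    nth_rw 1 [← Matrix.det_transpose M]
    rw [← Matrix.det_mul]
    congr 1
    ext i j
    rw [RingHom.mapMatrix_apply, Matrix.map_apply, Algebra.traceMatrix_apply,
      Algebra.traceForm_apply, FiniteField.algebraMap_trace_eq_sum_pow, hm, sum_range,
      Matrix.mul_apply]
    simp [M, mul_pow]
  have hfrob : M.det ^ p = (-1) ^ (m - 1) * M.det := by
    have h1 : (frobenius K p) M.det = (M.submatrix (finRotate m) id).det := by
      rw [RingHom.map_det]
      congr 1
      ext i j
      obtain ⟨k, rfl⟩ : ∃ k, m = k + 1 := ⟨m - 1, by omega⟩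
      simp only [RingHom.mapMatrix_apply, Matrix.map_apply, frobenius_def, M, Matrix.of_apply,
        Matrix.submatrix_apply, id, ← pow_mul, ← pow_succ]
      induction i using Fin.lastCases with
      | last => simp [← hcardK, FiniteField.pow_card]
      | cast i => simp
    rw [frobenius_def, Matrix.det_permute, sign_finRotate] at h1
    rw [h1]
    push_cast
    rfl
  have hne : Algebra.discr (ZMod p) v ≠ 0 := Algebra.discr_not_zero_of_basis (ZMod p) v
  have hdet : M.det ≠ 0 := by
    intro h
    rw [h, zero_pow two_ne_zero, map_eq_zero] at hsq
    exact hne hsq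
  have hodd : p = 2 * (p / 2) + 1 := by
    have := (Fact.out : p.Prime).eq_two_or_odd
    omega
  have hpow : M.det ^ (2 * (p / 2)) = (-1) ^ (m - 1) := by
    apply mul_right_cancel₀ hdet
    rw [← pow_succ, ← hodd, hfrob]
  have hK : ((quadraticChar (ZMod p) (Algebra.discr (ZMod p) v) : ℤ) : K)
      = (((-1) ^ (m - 1) : ℤ) : K) := by
    have := congrArg (algebraMap (ZMod p) K)
      (quadraticChar_eq_pow_of_char_ne_two' hchar (Algebra.discr (ZMod p) v))
    rw [map_intCast, map_pow, hsq, ZMod.card, ← pow_mul, hpow] at this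
    rw [this]
    push_cast
    rfl
  have hK2 : ringChar K ≠ 2 := by rwa [ringChar.eq K p]
  refine Int.cast_injOn_of_ringChar_ne_two hK2 ?_ ?_ hK
  · rcases quadraticChar_dichotomy hne with h5 | h5 <;> rw [h5] <;> simp
  · rcases neg_one_pow_eq_or ℤ (m - 1) with h6 | h6 <;> rw [h6] <;> simp

/-- The trace pullback of the standard additive character of `ZMod p`. -/
noncomputable def traceAddChar (p : ℕ) [Fact p.Prime] (K : Type*) [Field K] [Algebra (ZMod p) K] :
    AddChar K ℂ :=
  (ZMod.stdAddChar (N := p)).compAddMonoidHom (Algebra.trace (ZMod p) K).toAddMonoidHom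

omit [Fintype K] [DecidableEq K] in
lemma traceAddChar_apply {p : ℕ} [Fact p.Prime] [Algebra (ZMod p) K] (x : K) :
    traceAddChar p K x = ZMod.stdAddChar (Algebra.trace (ZMod p) K x) := rfl

omit [DecidableEq K] in
lemma traceAddChar_isPrimitive {p : ℕ} [Fact p.Prime] [Algebra (ZMod p) K] :
    (traceAddChar p K).IsPrimitive := by
  refine AddChar.IsPrimitive.of_ne_one fun h => ?_
  obtain ⟨x, hx⟩ := Algebra.trace_surjective (ZMod p) K 1
  have h1 := DFunLike.congr_fun h x
  rw [traceAddChar_apply, hx, AddChar.one_apply, ← (ZMod.stdAddChar (N := p)).map_zero_eq_one] at h1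
  exact one_ne_zero (ZMod.injective_stdAddChar h1)

lemma addChar_map_sum {ι A M : Type*} [AddCommMonoid A] [CommMonoid M] (ψ : AddChar A M)
    (s : Finset ι) (f : ι → A) : ψ (∑ i ∈ s, f i) = ∏ i ∈ s, ψ (f i) :=
  map_prod ψ.toMonoidHom (fun i => Multiplicative.ofAdd (f i)) s

/-- The Hasse–Davenport relation for the quadratic character over a prime field. -/
lemma gaussSum_traceAddChar_eq {p m : ℕ} [Fact p.Prime] (hp : p ≠ 2)
    [Algebra (ZMod p) K] (hm : Module.finrank (ZMod p) K = m) :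
    gaussSum (complexQuadraticChar K) (traceAddChar p K)
      = (-1) ^ (m - 1) * gaussSum (complexQuadraticChar (ZMod p)) ZMod.stdAddChar ^ m := by
  subst hm
  have hchar : ringChar (ZMod p) ≠ 2 := by rwa [ZMod.ringChar_zmod_n]
  have : CharP K p := charP_of_injective_algebraMap' (ZMod p) p
  have hK2 : ringChar K ≠ 2 := by rwa [ringChar.eq K p]
  have : Invertible (2 : ZMod p) := invertibleOfNonzero (Ring.two_ne_zero hchar)
  obtain ⟨v, hv⟩ := LinearMap.BilinForm.exists_orthogonal_basis
    (B := Algebra.traceForm (ZMod p) K) (LinearMap.isSymm_def.mpr fun x y =>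
      Algebra.traceForm_apply (ZMod p) x y ▸ (Algebra.traceForm_isSymm (ZMod p)).eq x y)
  have hdiag : Algebra.traceMatrix (ZMod p) v
      = Matrix.diagonal fun i => Algebra.trace (ZMod p) K (v i * v i) := by
    ext i j
    rw [Algebra.traceMatrix_apply, Matrix.diagonal_apply]
    split_ifs with hij
    · rw [hij, Algebra.traceForm_apply]
    · exact hv hij
  have hdiscr : Algebra.discr (ZMod p) v = ∏ i, Algebra.trace (ZMod p) K (v i * v i) := by
    rw [Algebra.discr_def, hdiag, Matrix.det_diagonal]
  have hne (i) : Algebra.trace (ZMod p) K (v i * v i) ≠ 0 := by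
    have := Algebra.discr_not_zero_of_basis (ZMod p) v
    rw [hdiscr, prod_ne_zero_iff] at this
    exact this i (mem_univ i)
  have htr (y : Fin (Module.finrank (ZMod p) K) → ZMod p) :
      Algebra.trace (ZMod p) K ((v.equivFun.symm y) ^ 2)
        = ∑ i, Algebra.trace (ZMod p) K (v i * v i) * y i ^ 2 := by
    rw [sq, ← Algebra.traceForm_apply, Module.Basis.equivFun_symm_apply]
    simp only [map_sum, LinearMap.sum_apply, map_smul, LinearMap.smul_apply]
    refine sum_congr rfl fun i _ => ?_
    rw [sum_eq_single i]
    · simp only [Algebra.traceForm_apply, smul_eq_mul]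
      ring
    · intro j _ hj
      rw [hv hj]
      simp
    · simp
  have h1 := sum_addChar_mul_sq hK2 (traceAddChar_isPrimitive (p := p) (K := K)) one_ne_zero
  simp only [map_one, Int.cast_one, one_mul] at h1
  rw [← h1, ← Equiv.sum_comp v.equivFun.symm.toEquiv]
  simp only [LinearEquiv.coe_toEquiv, traceAddChar_apply, htr, addChar_map_sum]
  rw [← Fintype.prod_sum (fun i t =>
    ZMod.stdAddChar (Algebra.trace (ZMod p) K (v i * v i) * t ^ 2))]
  simp only [sum_addChar_mul_sq hchar (ZMod.isPrimitive_stdAddChar p) (hne _)]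
  rw [prod_mul_distrib, prod_const, card_univ, Fintype.card_fin, ← Int.cast_prod, ← map_prod,
    ← hdiscr, quadraticChar_discr hp rfl v]
  push_cast
  rfl

end QuadraticGaussSum

section PrimeGaussSum

open Polynomial

lemma prod_neg_one_pow_mul_I (h : ℕ) :
    ∏ k ∈ range h, ((-1 : ℂ) ^ k * I) = if Even h then 1 else I := by
  induction h with
  | zero => simp
  | succ h ih =>
    rw [prod_range_succ, ih]
    rcases Nat.even_or_odd h with he | ho
    · simp [he, Nat.even_add_one]
    · simp [ho, ho.neg_one_pow, Nat.not_even_iff_odd.mpr ho]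

lemma epsC_eq {p h : ℕ} (hph : p = 2 * h + 1) : epsC p = if Even h then 1 else I := by
  rw [epsC]
  congr 1
  rw [Nat.even_iff, eq_iff_iff]
  omega

lemma epsC_sq {p h : ℕ} (hph : p = 2 * h + 1) : epsC p ^ 2 = (-1) ^ h := by
  rw [epsC_eq hph]
  rcases Nat.even_or_odd h with he | ho
  · simp [he, he.neg_one_pow]
  · simp [ho.neg_one_pow, Nat.not_even_iff_odd.mpr ho]

lemma sq_prod_pow_sub_pow {ω : ℂ} {p h : ℕ} (hph : p = 2 * h + 1) (hω : IsPrimitiveRoot ω p) :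
    (∏ k ∈ range h, (ω ^ (k + 1) - ω ^ (p - (k + 1)))) ^ 2 = (-1) ^ h * p := by
  have hω2 : IsPrimitiveRoot (ω ^ 2) (2 * h + 1) := by
    rw [← hph]
    exact hω.pow_of_coprime 2 (by rw [hph]; simp)
  have h1 := hω2.prod_one_sub_pow_eq_order
  rw [two_mul, prod_range_add, ← prod_range_reflect (fun x => 1 - (ω ^ 2) ^ (h + x + 1)),
    ← prod_mul_distrib] at h1
  have hc : (-1 : ℂ) ^ h = ∏ k ∈ range h, (-1 : ℂ) := by simp
  have h2 : (p : ℂ) = ((h + h : ℕ) : ℂ) + 1 := by rw [hph]; push_cast; ring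
  rw [h2, ← h1, hc, ← prod_pow, ← prod_mul_distrib]
  refine prod_congr rfl fun k hk => ?_
  have := mem_range.mp hk
  have h3 : ω ^ (k + 1) * ω ^ (p - (k + 1)) = 1 := by
    rw [← pow_add, Nat.add_sub_cancel' (by omega), hω.pow_eq_one]
  rw [show h + (h - 1 - k) + 1 = p - (k + 1) by omega, pow_right_comm ω 2, pow_right_comm ω 2]
  linear_combination (ω ^ (k + 1) * ω ^ (p - (k + 1)) - 1) * h3

lemma neg_exp_pow_sub_pow {p j : ℕ} (hp : Odd p) (hj : j ≤ p) :
    (-exp (Real.pi / p * I)) ^ j - (-exp (Real.pi / p * I)) ^ (p - j)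
      = (-1) ^ j * I * ((2 * Real.sin (j * Real.pi / p) : ℝ) : ℂ) := by
  have hp0 : (p : ℂ) ≠ 0 := by exact_mod_cast hp.pos.ne'
  have h1 : (-exp (Real.pi / p * I)) ^ j = (-1) ^ j * exp (j * Real.pi / p * I) := by
    rw [neg_pow, ← Complex.exp_nat_mul]
    congr 2
    ring
  have h2 : (-exp (Real.pi / p * I)) ^ (p - j) = (-1) ^ j * exp (-(j * Real.pi / p) * I) := by
    have h3 : (-1 : ℂ) ^ (p - j) = -(-1) ^ j := by
      have h4 : (-1 : ℂ) ^ (p - j) * (-1) ^ j = -1 := by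
        rw [← pow_add, Nat.sub_add_cancel hj, hp.neg_one_pow]
      have h5 : (-1 : ℂ) ^ j * (-1) ^ j = 1 := by rw [← mul_pow]; simp
      linear_combination (-1) ^ j * h4 - (-1) ^ (p - j) * h5
    rw [neg_pow, ← Complex.exp_nat_mul, h3, Nat.cast_sub hj,
      show ((p : ℂ) - j) * (Real.pi / p * I) = -(j * Real.pi / p) * I + Real.pi * I by
        field_simp; ring, Complex.exp_add, Complex.exp_pi_mul_I]
    ring
  rw [h1, h2]
  push_cast
  rw [Complex.sin]
  linear_combination (-1) ^ j * (exp (-(j * Real.pi / p) * I) - exp (j * Real.pi / p * I)) * -I_sq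

/-- Gauss's determination of the sign of the quadratic Gauss sum. -/
theorem gaussSum_stdAddChar {p : ℕ} [Fact p.Prime] (hp : p ≠ 2) :
    gaussSum (complexQuadraticChar (ZMod p)) ZMod.stdAddChar = epsC p * (Real.sqrt p : ℂ) := by
  have hpp : p.Prime := Fact.out
  obtain ⟨h, hph⟩ : ∃ h, p = 2 * h + 1 := hpp.odd_of_ne_two hp
  have hchar : ringChar (ZMod p) ≠ 2 := by rwa [ZMod.ringChar_zmod_n]
  have hp0 : (p : ℂ) ≠ 0 := by exact_mod_cast hpp.ne_zero
  set g := gaussSum (complexQuadraticChar (ZMod p)) ZMod.stdAddChar with hg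
  have hgsq : g ^ 2 = (-1) ^ h * p := by
    rw [hg, gaussSum_sq (complexQuadraticChar_ne_one hchar) complexQuadraticChar_isQuadratic
      (ZMod.isPrimitive_stdAddChar p), complexQuadraticChar_apply, quadraticChar_neg_one hchar,
      ZMod.card, ZMod.χ₄_eq_neg_one_pow (by omega), show p / 2 = h by omega]
    push_cast
    rfl
  have hu2 : (2 : ZMod p) * ((h + 1 : ℕ) : ZMod p) = 1 := by
    have h3 : ((2 * h + 1 : ℕ) : ZMod p) = 0 := by rw [← hph, CharP.cast_eq_zero]
    push_cast at h3 ⊢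
    linear_combination h3
  let u : (ZMod p)ˣ := ⟨((h + 1 : ℕ) : ZMod p), 2, by rw [mul_comm, hu2], hu2⟩
  let ω : ℂ := ZMod.stdAddChar (u : ZMod p)
  have hωpow (k : ℕ) : ω ^ k = ZMod.stdAddChar ((u : ZMod p) * (k : ZMod p)) := by
    rw [← AddChar.map_nsmul_eq_pow, nsmul_eq_mul, mul_comm]
  have hωexp : ω = -exp (Real.pi / p * I) := by
    have h1 := ZMod.stdAddChar_coe (N := p) (h + 1 : ℕ)
    rw [Int.cast_natCast] at h1
    have h2 : 2 * (Real.pi : ℂ) * I * ((h + 1 : ℕ) : ℤ) / p = Real.pi / p * I + Real.pi * I := by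
      have h3 : (p : ℂ) = 2 * h + 1 := by rw [hph]; push_cast; ring
      field_simp
      rw [h3]
      push_cast
      ring
    rw [h2, Complex.exp_add, Complex.exp_pi_mul_I, mul_neg_one] at h1
    exact h1
  have hω : IsPrimitiveRoot ω p := by
    have h1 : orderOf ω = p := by
      refine orderOf_eq_prime ?_ fun h1 => ?_
      · rw [hωpow, CharP.cast_eq_zero, mul_zero, AddChar.map_zero_eq_one]
      · rw [← (ZMod.stdAddChar (N := p)).map_zero_eq_one] at h1
        exact u.ne_zero (ZMod.injective_stdAddChar h1)
    rw [← h1]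
    exact IsPrimitiveRoot.orderOf ω
  set Q := ∏ k ∈ range h, (ω ^ (k + 1) - ω ^ (p - (k + 1))) with hQ
  set g' := gaussSum (complexQuadraticChar (ZMod p)) (ZMod.stdAddChar.mulShift u) with hg'
  have hgg' : (quadraticChar (ZMod p) u : ℂ) * g' = g := by
    rw [← complexQuadraticChar_apply]
    exact gaussSum_mulShift _ _ u
  have hg'eval : g' = ∑ j ∈ range p, (quadraticChar (ZMod p) (j : ZMod p) : ℂ) * ω ^ j := by
    refine sum_nbij' (fun x => x.val) (fun j => (j : ZMod p)) ?_ ?_ ?_ ?_ ?_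
    · exact fun x _ => mem_range.mpr x.val_lt
    · simp
    · exact fun x _ => ZMod.natCast_zmod_val x
    · exact fun j hj => ZMod.val_cast_of_lt (mem_range.mp hj)
    · intro x _
      rw [hωpow, ZMod.natCast_zmod_val, complexQuadraticChar_apply, AddChar.mulShift_apply]
  have husq : (quadraticChar (ZMod p) u : ℂ) ^ 2 = 1 := by
    exact_mod_cast quadraticChar_sq_one u.ne_zero
  have hsq : g' ^ 2 = Q ^ 2 := by
    rw [sq_prod_pow_sub_pow hph hω, ← hgsq, ← hgg', mul_pow, husq, one_mul]
  obtain ⟨s, hs, hg's⟩ : ∃ s : ℤ, (s = 1 ∨ s = -1) ∧ g' = s * Q := by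
    rcases sq_eq_sq_iff_eq_or_eq_neg.mp hsq with h1 | h1
    · exact ⟨1, Or.inl rfl, by simpa using h1⟩
    · exact ⟨-1, Or.inr rfl, by simpa using h1⟩
  have hs' := sign_eq_of_cyclotomic_dvd hph hs (by
    rw [cyclotomic_eq_minpoly hω hpp.pos]
    refine minpoly.isIntegrallyClosed_dvd (hω.isIntegral hpp.pos) ?_
    simp only [map_sub, map_mul, map_sum, map_prod, map_pow, aeval_X, eq_intCast, map_intCast]
    rw [← hg'eval, ← hQ, hg's, sub_self])
  have hgQ : g = (-1) ^ h * Q := by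
    have h1 : (quadraticChar (ZMod p) u : ℂ) * (quadraticChar (ZMod p) 2 : ℂ) = 1 := by
      rw [← Int.cast_mul, ← map_mul, mul_comm, hu2, map_one, Int.cast_one]
    rw [← hgg', hg's, hs']
    push_cast
    linear_combination (-1) ^ h * Q * h1
  let r : ℝ := ∏ k ∈ range h, (2 * Real.sin ((k + 1 : ℕ) * Real.pi / p))
  have hr : 0 < r := by
    refine prod_pos fun k hk => mul_pos two_pos (Real.sin_pos_of_pos_of_lt_pi ?_ ?_)
    · have := hpp.pos
      positivity
    · have h1 : ((k + 1 : ℕ) : ℝ) < p := by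
        have := mem_range.mp hk
        exact_mod_cast (by omega : k + 1 < p)
      rw [div_lt_iff₀ (by exact_mod_cast hpp.pos), mul_comm]
      exact mul_lt_mul_of_pos_left h1 Real.pi_pos
  have hgr : g = epsC p * r := by
    have hc : (-1 : ℂ) ^ h = ∏ k ∈ range h, (-1 : ℂ) := by simp
    rw [hgQ, epsC_eq hph, ← prod_neg_one_pow_mul_I, hQ, hc, Complex.ofReal_prod,
      ← prod_mul_distrib, ← prod_mul_distrib]
    refine prod_congr rfl fun k hk => ?_
    have := mem_range.mp hk
    rw [hωexp, neg_exp_pow_sub_pow ⟨h, hph⟩ (by omega), pow_succ]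
    ring
  have hrsq : r ^ 2 = p := by
    rw [hgr, mul_pow, epsC_sq hph] at hgsq
    exact_mod_cast mul_left_cancel₀ (pow_ne_zero h (neg_ne_zero.mpr one_ne_zero)) hgsq
  rw [hgr, ← hrsq, Real.sqrt_sq hr.le]

end PrimeGaussSum

section HybridSum

lemma zetaP_eq_stdAddChar {p : ℕ} [Fact p.Prime] (k : ZMod p) : zetaP p k = ZMod.stdAddChar k := by
  rw [ZMod.stdAddChar_apply, ZMod.toCircle_apply, zetaP]

lemma sum_complexQuadraticChar_mul {K : Type*} [Field K] [Fintype K] [DecidableEq K]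
    (hK : ringChar K ≠ 2) (ψ : AddChar K ℂ) (y : K) :
    ∑ c, (quadraticChar K c : ℂ) * ψ (c * y)
      = (quadraticChar K y : ℂ) * gaussSum (complexQuadraticChar K) ψ := by
  rcases eq_or_ne y 0 with rfl | hy
  · simp only [mul_zero, AddChar.map_zero_eq_one, mul_one, MulChar.map_zero, Int.cast_zero, zero_mul]
    exact_mod_cast quadraticChar_sum_zero hK
  · have h := gaussSum_mulShift_eq (complexQuadraticChar K) ψ (Units.mk0 y hy)
    rw [complexQuadraticChar_isQuadratic.inv] at h
    simp only [mul_comm _ y]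
    exact h

lemma sum_erase_zero_zpow {K M : Type*} [Field K] [Fintype K] [DecidableEq K] [AddCommMonoid M]
    {d : ℕ} (hd : 1 ≤ d) (hgcd : Nat.gcd (d - 1) (Fintype.card K - 1) = 1) (f : K → M) :
    ∑ c ∈ univ.erase 0, f (c ^ ((1 : ℤ) - d)) = ∑ c ∈ univ.erase 0, f c := by
  have hmaps : Set.MapsTo (fun c : K => c ^ ((1 : ℤ) - d)) (univ.erase (0 : K))
      (univ.erase (0 : K)) := by
    intro c hc
    have hc0 : c ≠ 0 := by simpa using hc
    simpa using zpow_ne_zero _ hc0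
  have hinj : Set.InjOn (fun c : K => c ^ ((1 : ℤ) - d)) (univ.erase (0 : K)) := by
    intro c hc c' hc' h
    have hc0 : c ≠ 0 := by simpa using hc
    have hc0' : c' ≠ 0 := by simpa using hc'
    have h1 : (c / c') ^ (d - 1) = 1 := by
      have h2 : (1 : ℤ) - d = -((d - 1 : ℕ) : ℤ) := by omega
      simp only [h2, zpow_neg, zpow_natCast, inv_inj] at h
      rw [div_pow, h, div_self (pow_ne_zero _ hc0')]
    have h2 : (c / c') ^ (Fintype.card K - 1) = 1 :=
      FiniteField.pow_card_sub_one_eq_one _ (div_ne_zero hc0 hc0')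
    have h3 : orderOf (c / c') ∣ 1 :=
      hgcd ▸ Nat.dvd_gcd (orderOf_dvd_of_pow_eq_one h1) (orderOf_dvd_of_pow_eq_one h2)
    have h4 := orderOf_eq_one_iff.mp (Nat.dvd_one.mp h3)
    rwa [div_eq_one_iff_eq hc0'] at h4
  exact sum_nbij _ hmaps hinj (surjOn_of_injOn_of_card_le _ hmaps hinj le_rfl) fun _ _ => rfl

lemma sum_erase_zero_addChar_mul {K : Type*} [Field K] [Fintype K] [DecidableEq K]
    {ψ : AddChar K ℂ} (hψ : ψ.IsPrimitive) (b : K) :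
    ∑ c ∈ univ.erase 0, ψ (c * b) = if b = 0 then (Fintype.card K : ℂ) - 1 else -1 := by
  have h := AddChar.sum_mulShift b hψ
  rw [← add_sum_erase _ _ (mem_univ 0), zero_mul, AddChar.map_zero_eq_one] at h
  split_ifs at h ⊢
  · linear_combination h
  · push_cast at h
    linear_combination h

end HybridSum

/-- Evaluation of `S_2`: under Condition II with constant `υ ∈ {±ϵ^m}`, for
`a ≠ 0` the hybrid sum `S_2 = Σ_{x ∈ V} η_m(F(x)) χ_1(ax)` equals
`((p^m-1)/p^m) υ p^{n/2} (-1)^{m-1} ϵ^m √(p^m) η_m(-1)` if `F^*(a) = 0` and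
`-(1/p^m) υ p^{n/2} (-1)^{m-1} ϵ^m √(p^m) η_m(-1)` if `F^*(a) ≠ 0`. -/
theorem hybrid_sum_S2_eval
    (p n m d : ℕ) [Fact p.Prime] (hp : p ≠ 2)
    (hm : 1 ≤ m) (hmn : m ≤ n) (hnm : Even (n - m)) (hn3m : 3 * m ≤ n)
    (V : Type*) [AddCommGroup V] [Module (ZMod p) V] [Fintype V]
    (hV : Fintype.card V = p ^ n)
    (K : Type*) [Field K] [Fintype K] [DecidableEq K] [Algebra (ZMod p) K]
    (hK : Fintype.card K = p ^ m)
    (B : V →ₗ[ZMod p] V →ₗ[ZMod p] ZMod p)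
    (hBsym : ∀ v w, B v w = B w v)
    (hBnd : ∀ v, (∀ w, B v w = 0) → v = 0)
    (F Fstar : V → K)
    (υ : ℂ) (hυ : υ = epsC p ^ m ∨ υ = -(epsC p ^ m))
    (hd : 2 ≤ d) (hdeven : Even d)
    (hgcd : Nat.gcd (d - 1) (p ^ m - 1) = 1)
    (hF0 : F 0 = 0) (hFstar0 : Fstar 0 = 0)
    (hFstarneg : ∀ a : V, Fstar (-a) = Fstar a)
    (hWalsh : ∀ c : K, c ≠ 0 → ∀ a : V,
      ∑ x : V, zetaP p (Algebra.trace (ZMod p) K (c * F x) - B a x)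
        = υ * (quadraticChar K c : ℂ) * (Real.sqrt ((p : ℝ) ^ n) : ℂ)
            * zetaP p (Algebra.trace (ZMod p) K (c ^ ((1 : ℤ) - d) * Fstar a)))
    (a : V) (ha : a ≠ 0) :
    (Fstar a = 0 →
      ∑ x : V, (quadraticChar K (F x) : ℂ) * zetaP p (B a x)
        = (((p : ℂ) ^ m - 1) / (p : ℂ) ^ m) * υ * (Real.sqrt ((p : ℝ) ^ n) : ℂ)
            * (-1) ^ (m - 1) * epsC p ^ m * (Real.sqrt ((p : ℝ) ^ m) : ℂ)
            * (quadraticChar K (-1) : ℂ))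
    ∧ (Fstar a ≠ 0 →
      ∑ x : V, (quadraticChar K (F x) : ℂ) * zetaP p (B a x)
        = -((1 : ℂ) / (p : ℂ) ^ m) * υ * (Real.sqrt ((p : ℝ) ^ n) : ℂ)
            * (-1) ^ (m - 1) * epsC p ^ m * (Real.sqrt ((p : ℝ) ^ m) : ℂ)
            * (quadraticChar K (-1) : ℂ)) := by
  have hchar : ringChar (ZMod p) ≠ 2 := by rwa [ZMod.ringChar_zmod_n]
  have : CharP K p := charP_of_injective_algebraMap' (ZMod p) p
  have hK2 : ringChar K ≠ 2 := by rwa [ringChar.eq K p]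
  have hpp : p.Prime := Fact.out
  have hfin : Module.finrank (ZMod p) K = m := by
    rw [Module.card_eq_pow_finrank (K := ZMod p), ZMod.card] at hK
    exact Nat.pow_right_injective hpp.two_le hK
  have hψ := traceAddChar_isPrimitive (p := p) (K := K)
  have hpm : (p : ℂ) ^ m ≠ 0 := pow_ne_zero _ (by exact_mod_cast hpp.ne_zero)
  set G := gaussSum (complexQuadraticChar K) (traceAddChar p K) with hG
  have hGval : G = (-1) ^ (m - 1) * epsC p ^ m * (Real.sqrt ((p : ℝ) ^ m) : ℂ) := by
    rw [hG, gaussSum_traceAddChar_eq hp hfin, gaussSum_stdAddChar hp, mul_pow, ← Complex.ofReal_pow,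
      Real.sqrt_eq_rpow, Real.sqrt_eq_rpow, ← Real.rpow_natCast_mul (Nat.cast_nonneg p),
      ← Real.rpow_mul_natCast (Nat.cast_nonneg p), mul_comm (m : ℝ), mul_assoc]
  have hGsq : G * G = (quadraticChar K (-1) : ℂ) * (p : ℂ) ^ m := by
    rw [← sq, hG, gaussSum_sq (complexQuadraticChar_ne_one hK2) complexQuadraticChar_isQuadratic hψ,
      hK, complexQuadraticChar_apply]
    push_cast
    rfl
  have hη : (quadraticChar K (-1) : ℂ) * (quadraticChar K (-1) : ℂ) = 1 := by
    rw [← Int.cast_mul, ← map_mul]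
    simp
  set S := ∑ x : V, (quadraticChar K (F x) : ℂ) * zetaP p (B a x) with hS
  have hwalsh (c : K) (hc : c ≠ 0) :
      ∑ x : V, traceAddChar p K (c * F x) * ZMod.stdAddChar (B a x)
        = υ * (quadraticChar K c : ℂ) * (Real.sqrt ((p : ℝ) ^ n) : ℂ)
            * traceAddChar p K (c ^ ((1 : ℤ) - d) * Fstar a) := by
    have h1 := hWalsh c hc (-a)
    simp only [hFstarneg, map_neg, LinearMap.neg_apply, sub_neg_eq_add, zetaP_eq_stdAddChar,
      AddChar.map_add_eq_mul] at h1
    exact h1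
  have hGS : S * G = υ * (Real.sqrt ((p : ℝ) ^ n) : ℂ)
      * if Fstar a = 0 then (p : ℂ) ^ m - 1 else -1 := by
    have hcard : (p : ℂ) ^ m = (Fintype.card K : ℂ) := by rw [hK]; push_cast; rfl
    rw [hcard, ← sum_erase_zero_addChar_mul hψ (Fstar a),
      ← sum_erase_zero_zpow (by omega) (hK ▸ hgcd) (fun c => traceAddChar p K (c * Fstar a)),
      Finset.mul_sum, hS, Finset.sum_mul]
    calc ∑ x, (quadraticChar K (F x) : ℂ) * zetaP p (B a x) * G
        = ∑ x, ∑ c, (quadraticChar K c : ℂ)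
            * (traceAddChar p K (c * F x) * ZMod.stdAddChar (B a x)) := by
          refine Finset.sum_congr rfl fun x _ => ?_
          rw [mul_right_comm, ← sum_complexQuadraticChar_mul hK2, Finset.sum_mul,
            zetaP_eq_stdAddChar]
          exact Finset.sum_congr rfl fun c _ => mul_assoc _ _ _
      _ = ∑ c, (quadraticChar K c : ℂ)
            * ∑ x, traceAddChar p K (c * F x) * ZMod.stdAddChar (B a x) := by
          rw [Finset.sum_comm]
          simp only [Finset.mul_sum]
      _ = ∑ c ∈ Finset.univ.erase 0, (quadraticChar K c : ℂ)
            * ∑ x, traceAddChar p K (c * F x) * ZMod.stdAddChar (B a x) := by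
          rw [← Finset.add_sum_erase _ _ (Finset.mem_univ (0 : K))]
          simp
      _ = _ := by
          refine Finset.sum_congr rfl fun c hc => ?_
          have hc0 := Finset.ne_of_mem_erase hc
          have h1 : (quadraticChar K c : ℂ) ^ 2 = 1 := by
            exact_mod_cast quadraticChar_sq_one hc0
          rw [hwalsh c hc0]
          linear_combination υ * (Real.sqrt ((p : ℝ) ^ n) : ℂ)
            * traceAddChar p K (c ^ ((1 : ℤ) - d) * Fstar a) * h1
  have hSG : S * (p : ℂ) ^ m = S * G * G * (quadraticChar K (-1) : ℂ) := by
    linear_combination -S * (quadraticChar K (-1) : ℂ) * hGsq - S * (p : ℂ) ^ m * hη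
  constructor <;> intro ha0 <;> apply mul_right_cancel₀ hpm <;> rw [hSG, hGS, hGval]
  · rw [if_pos ha0]
    field_simp
  · rw [if_neg ha0]
    field_simp
end
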